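/- arXiv:2601.12447 — 7 statements merged into one kernel-verified Lean document; each statement's English description precedes it below -/
import Mathlib

section
/- Let μ and ν be probability measures on ℝ, let ε ≥ 0 and 0 ≤ δ < 1/3, and suppose that for every measurable set S ⊆ ℝ one has ν(S) ≤ e^ε · μ(S) + δ. Let τ > 0 and let v, v' ∈ ℝ satisfy |v − v'| > 2τ. If μ({x : |x − v| ≤ τ}) ≥ 2/3 and ν({x : |x − v'| ≤ τ}) ≥ 2/3, then e^ε ≥ 2 − 3δ, and in particular ε ≥ ln(2 − 3δ). (This is the hypothesis-testing reduction underlying the privacy lower bound for fairness verification: any differentially private mechanism that estimates a statistic to within τ on two adjacent datasets whose statistic values differ by more than 2τ must have privacy parameter ε bounded below.) -/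
open MeasureTheory

/-- **Privacy lower bound via hypothesis testing.**
If `ν(S) ≤ e^ε μ(S) + δ` for all measurable `S` (with `0 ≤ δ < 1/3`), and
`μ` puts mass `≥ 2/3` within `τ` of `v` while `ν` puts mass `≥ 2/3` within `τ`
of `v'`, where `|v − v'| > 2τ`, then `e^ε ≥ 2 − 3δ` and hence
`ε ≥ ln (2 − 3δ)`. -/
theorem privacy_lower_bound_fairness_verification
    (μ ν : Measure ℝ) [IsProbabilityMeasure μ] [IsProbabilityMeasure ν]
    (ε δ : ℝ) (hε : 0 ≤ ε) (hδ0 : 0 ≤ δ) (hδ : δ < 1 / 3)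
    (hDP : ∀ S : Set ℝ, MeasurableSet S →
      ν S ≤ ENNReal.ofReal (Real.exp ε) * μ S + ENNReal.ofReal δ)
    (τ : ℝ) (hτ : 0 < τ) (v v' : ℝ) (hvv : 2 * τ < |v - v'|)
    (hμ : ENNReal.ofReal (2 / 3) ≤ μ {x | |x - v| ≤ τ})
    (hν : ENNReal.ofReal (2 / 3) ≤ ν {x | |x - v'| ≤ τ}) :
    2 - 3 * δ ≤ Real.exp ε ∧ Real.log (2 - 3 * δ) ≤ ε := by
  have hmA : MeasurableSet {x : ℝ | |x - v| ≤ τ} :=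
    measurableSet_le (by fun_prop) (by fun_prop)
  have hmB : MeasurableSet {x : ℝ | |x - v'| ≤ τ} :=
    measurableSet_le (by fun_prop) (by fun_prop)
  have hdisj : Disjoint {x : ℝ | |x - v| ≤ τ} {x : ℝ | |x - v'| ≤ τ} := by
    rw [Set.disjoint_left]
    intro x hx hx'
    simp only [Set.mem_setOf_eq] at hx hx'
    have h := abs_sub_le v x v'
    rw [abs_sub_comm v x] at h
    linarith
  have hB := hDP _ hmB
  have hsum : μ.real {x : ℝ | |x - v| ≤ τ} + μ.real {x : ℝ | |x - v'| ≤ τ} ≤ 1 := by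
    rw [← measureReal_union hdisj hmB]
    exact measureReal_le_one
  have hμ' : 2 / 3 ≤ μ.real {x : ℝ | |x - v| ≤ τ} :=
    (ENNReal.ofReal_le_iff_le_toReal (measure_ne_top _ _)).1 hμ
  have hE := Real.exp_pos ε
  have h1 := hν.trans hB
  rw [← ofReal_measureReal (μ := μ), ← ENNReal.ofReal_mul hE.le,
    ← ENNReal.ofReal_add (by positivity) hδ0,
    ENNReal.ofReal_le_ofReal_iff (by positivity)] at h1
  have key : 2 - 3 * δ ≤ Real.exp ε := by
    nlinarith
  exact ⟨key, (Real.log_le_iff_le_exp (by linarith)).2 key⟩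
end

section
/- Fix ε₀ ≥ 0, δ₀ ≥ 0, a positive integer T, and δ' ∈ (0, 1). For each t = 1, …, T let μ_t and ν_t be probability measures on a measurable space Ω_t such that for every measurable set S ⊆ Ω_t both μ_t(S) ≤ e^{ε₀} · ν_t(S) + δ₀ and ν_t(S) ≤ e^{ε₀} · μ_t(S) + δ₀ hold. Then the product measures satisfy, for every measurable set S ⊆ Ω₁ × ⋯ × Ω_T, (⊗_{t=1}^{T} μ_t)(S) ≤ e^{ε_T} · (⊗_{t=1}^{T} ν_t)(S) + T·δ₀ + δ', where ε_T = √(2T · ln(1/δ')) · ε₀ + T · ε₀ · (e^{ε₀} − 1). (Advanced composition for T rounds of fairness verification: T independent (ε₀, δ₀)-indistinguishable mechanisms compose to an (ε_T, T·δ₀ + δ')-indistinguishable mechanism.) -/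
open MeasureTheory

lemma AC_le_pi {n : ℕ} {Ω : Fin n → Type*} [∀ t, MeasurableSpace (Ω t)]
    (μ μ' : ∀ t, Measure (Ω t)) [∀ t, IsProbabilityMeasure (μ' t)] (c : ENNReal)
    (h : ∀ t, c • μ' t ≤ μ t) : (c ^ n) • Measure.pi μ' ≤ Measure.pi μ := by
  rw [Measure.le_iff]
  intro S hS
  have h1 : ((c ^ n) • Measure.pi μ').toOuterMeasure
      ≤ OuterMeasure.pi fun i => (μ i).toOuterMeasure := by
    rw [OuterMeasure.le_pi]
    intro s _
    have : (c ^ n) * ∏ i, μ' i (s i) = ∏ i, (c * μ' i (s i)) := by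
      rw [Finset.prod_mul_distrib]; simp
    have h2 : ((c ^ n) • Measure.pi μ') (Set.pi Set.univ s) ≤ ∏ i, μ i (s i) := by
      rw [Measure.smul_apply, Measure.pi_pi, smul_eq_mul, this]
      refine Finset.prod_le_prod' fun i _ => ?_
      have := h i (s i)
      simpa using this
    exact h2
  rw [Measure.pi_def μ, toMeasure_apply _ _ hS]
  exact h1 S

lemma AC_pi_withDensity {n : ℕ} {Ω : Fin n → Type*} [∀ t, MeasurableSpace (Ω t)]
    (μ ν : ∀ t, Measure (Ω t)) [∀ t, IsProbabilityMeasure (μ t)]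
    [∀ t, IsProbabilityMeasure (ν t)]
    (r : ∀ t, Ω t → ENNReal) (hr : ∀ t, Measurable (r t))
    (h : ∀ t, μ t = (ν t).withDensity (r t)) :
    Measure.pi μ = (Measure.pi ν).withDensity (fun x => ∏ t, r t (x t)) := by
  apply Measure.pi_eq
  intro s hs
  have hm : MeasurableSet (Set.pi Set.univ s) := MeasurableSet.univ_pi hs
  rw [withDensity_apply _ hm, ← lintegral_indicator hm]
  have e : ∀ x : ∀ t, Ω t, (Set.pi Set.univ s).indicator (fun x => ∏ t, r t (x t)) x
      = ∏ t, (s t).indicator (r t) (x t) := by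
    intro x
    by_cases hx : x ∈ Set.pi Set.univ s
    · rw [Set.indicator_of_mem hx]
      refine Finset.prod_congr rfl fun t _ => ?_
      rw [Set.indicator_of_mem (hx t trivial)]
    · rw [Set.indicator_of_notMem hx]
      simp only [Set.mem_univ_pi, not_forall] at hx
      obtain ⟨t, ht⟩ := hx
      exact (Finset.prod_eq_zero (Finset.mem_univ t) (Set.indicator_of_notMem ht _)).symm
  simp_rw [e]
  have hmi : ∀ t, Measurable ((s t).indicator (r t)) := fun t => (hr t).indicator (hs t)
  have hi := ProbabilityTheory.iIndepFun_pi (μ := ν) (X := fun t => (s t).indicator (r t))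
    (fun t => (hmi t).aemeasurable)
  rw [ProbabilityTheory.lintegral_prod_eq_prod_lintegral_of_indepFun Finset.univ _ hi
    (fun t => (hmi t).comp (measurable_pi_apply t))]
  refine Finset.prod_congr rfl fun t _ => ?_
  rw [h t, withDensity_apply _ (hs t), ← lintegral_indicator (hs t)]
  rw [← (measurePreserving_eval ν t).lintegral_comp (hmi t)]

lemma AC_pointwise (ε L : ℝ) (hL : |L| ≤ ε) :
    L - 1 + Real.exp (-L) ≤ ε * (Real.exp ε - 1) := by
  have hε : 0 ≤ ε := (abs_nonneg L).trans hL
  obtain ⟨h1, h2⟩ := abs_le.1 hL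
  have a1 := Real.add_one_le_exp L
  have a2 : Real.exp L * Real.exp (-L) = 1 := by rw [← Real.exp_add]; simp
  have a3 := Real.exp_pos (-L)
  have a4 : L * Real.exp (-L) ≤ 1 - Real.exp (-L) := by nlinarith
  have a5 : L * (1 - Real.exp (-L)) ≤ ε * (Real.exp ε - 1) := by
    have b1 : Real.exp (-L) ≤ Real.exp ε := Real.exp_le_exp.2 (by linarith)
    have b2 := Real.add_one_le_exp ε
    have b3 := Real.add_one_le_exp (-ε)
    have b4 : Real.exp (-ε) ≤ Real.exp (-L) := Real.exp_le_exp.2 (by linarith)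
    rcases le_total 0 L with h0 | h0
    · have : Real.exp (-L) ≤ 1 := by simpa using h0
      have : 1 - Real.exp (-L) ≤ Real.exp ε - 1 := by linarith
      exact mul_le_mul h2 this (by linarith) hε
    · have : 1 ≤ Real.exp (-L) := by simpa using h0
      have := mul_le_mul (show -L ≤ ε by linarith) (show Real.exp (-L) - 1 ≤ Real.exp ε - 1 by linarith) (by linarith) hε
      linarith
  nlinarith

lemma AC_mean {Ω : Type*} [MeasurableSpace Ω] (μ ν : Measure Ω) [IsProbabilityMeasure μ]
    [IsProbabilityMeasure ν] (ε : ℝ) (L : Ω → ℝ) (hL : Measurable L) (hb : ∀ x, |L x| ≤ ε)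
    (h : μ = ν.withDensity (fun x => ENNReal.ofReal (Real.exp (L x)))) :
    ∫ x, L x ∂μ ≤ ε * (Real.exp ε - 1) := by
  have i1 : Integrable L μ := Integrable.of_bound hL.aestronglyMeasurable ε
    (Filter.Eventually.of_forall fun x => by simpa using hb x)
  have i2 : Integrable (fun x => Real.exp (-L x)) μ :=
    Integrable.of_bound (by fun_prop) (Real.exp ε)
    (Filter.Eventually.of_forall fun x => by
      simpa using (by linarith [(abs_le.1 (hb x)).1] : -L x ≤ ε))
  have e : ∫ x, Real.exp (-L x) ∂μ = 1 := by
    rw [integral_eq_lintegral_of_nonneg_ae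
      (Filter.Eventually.of_forall fun x => (Real.exp_pos _).le) (by fun_prop)]
    rw [h, lintegral_withDensity_eq_lintegral_mul _ (by fun_prop) (by fun_prop)]
    have : ∀ x, ((fun x => ENNReal.ofReal (Real.exp (L x))) *
        fun x => ENNReal.ofReal (Real.exp (-L x))) x = 1 := by
      intro x
      rw [Pi.mul_apply, ← ENNReal.ofReal_mul (Real.exp_pos _).le, ← Real.exp_add]
      simp
    rw [lintegral_congr this]
    simp
  have k : ∫ x, (L x - 1 + Real.exp (-L x)) ∂μ ≤ ∫ x, ε * (Real.exp ε - 1) ∂μ :=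
    integral_mono ((i1.sub (integrable_const 1)).add i2) (integrable_const _)
      (fun x => AC_pointwise ε (L x) (hb x))
  have i3 : Integrable (fun x => L x - 1) μ := i1.sub (integrable_const 1)
  rw [integral_add i3 i2,
    integral_sub i1 (integrable_const 1), e] at k
  simpa using k

lemma AC_balance_aux {Ω : Type*} [MeasurableSpace Ω] (ρ : Measure Ω) (f g : Ω → ℝ) (E : ℝ)
    (hE : 1 ≤ E) (hf : Measurable f) (hg : Measurable g) (f0 : ∀ x, 0 ≤ f x) (g0 : ∀ x, 0 ≤ g x)
    (fi : Integrable f ρ) (gi : Integrable g ρ) (hfg : ∀ x, f x ≤ E * g x)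
    (hgf : ∀ x, g x ≤ E * f x) (hle : ∫ x, f x ∂ρ ≤ ∫ x, g x ∂ρ) :
    ∃ g' : Ω → ℝ, Measurable g' ∧ Integrable g' ρ ∧ (∀ x, 0 ≤ g' x) ∧ (∀ x, g' x ≤ g x) ∧
      (∀ x, f x ≤ E * g' x) ∧ (∀ x, g' x ≤ E * f x) ∧ ∫ x, g' x ∂ρ = ∫ x, f x ∂ρ := by
  set a := ∫ x, f x ∂ρ with ha
  set b := ∫ x, g x ∂ρ with hb
  have a0 : 0 ≤ a := integral_nonneg f0
  have E0 : 0 < E := by linarith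
  have hEi : E⁻¹ ≤ 1 := inv_le_one_of_one_le₀ hE
  have hEi0 : 0 < E⁻¹ := inv_pos.2 E0
  have hEE : E * E⁻¹ = 1 := mul_inv_cancel₀ E0.ne'
  have haE : E⁻¹ * a ≤ a := by nlinarith
  obtain ⟨s, s0, s1, hs⟩ : ∃ s : ℝ, 0 ≤ s ∧ s ≤ 1 ∧ (1 - s) * b + s * (E⁻¹ * a) = a := by
    by_cases hd : b - E⁻¹ * a = 0
    · exact ⟨0, le_rfl, zero_le_one, by linarith⟩
    · have hd' : 0 < b - E⁻¹ * a := lt_of_le_of_ne (by linarith) (Ne.symm hd)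
      refine ⟨(b - a) / (b - E⁻¹ * a), div_nonneg (by linarith) hd'.le, ?_, ?_⟩
      · rw [div_le_one hd']; linarith
      · have : (b - a) / (b - E⁻¹ * a) * (b - E⁻¹ * a) = b - a := div_mul_cancel₀ _ hd
        linarith
  have c1 : ∀ x, E⁻¹ * f x ≤ g x := fun x => by
    rw [inv_mul_le_iff₀ E0]; exact hfg x
  refine ⟨fun x => (1 - s) * g x + s * (E⁻¹ * f x), by fun_prop, by fun_prop, ?_, ?_, ?_, ?_, ?_⟩
  · intro x
    have := g0 x; have := f0 x
    have : 0 ≤ 1 - s := by linarith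
    positivity
  · intro x; nlinarith [c1 x]
  · intro x
    have : E * ((1 - s) * g x + s * (E⁻¹ * f x)) = (1 - s) * (E * g x) + s * f x := by
      linear_combination (s * f x) * hEE
    rw [this]
    nlinarith [hfg x]
  · intro x
    have : E⁻¹ * f x ≤ E * f x := mul_le_mul_of_nonneg_right (by linarith) (f0 x)
    nlinarith [hgf x]
  · rw [integral_add (by fun_prop) (by fun_prop), integral_const_mul, integral_const_mul,
      integral_const_mul]
    exact hs

lemma AC_balance {Ω : Type*} [MeasurableSpace Ω] (ρ : Measure Ω) (f g : Ω → ℝ) (E : ℝ)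
    (hE : 1 ≤ E) (hf : Measurable f) (hg : Measurable g) (f0 : ∀ x, 0 ≤ f x) (g0 : ∀ x, 0 ≤ g x)
    (fi : Integrable f ρ) (gi : Integrable g ρ) (hfg : ∀ x, f x ≤ E * g x)
    (hgf : ∀ x, g x ≤ E * f x) (m : ℝ) (hm1 : m ≤ ∫ x, f x ∂ρ) (hm2 : m ≤ ∫ x, g x ∂ρ) :
    ∃ f' g' : Ω → ℝ, Measurable f' ∧ Measurable g' ∧ Integrable f' ρ ∧ Integrable g' ρ ∧
      (∀ x, 0 ≤ f' x) ∧ (∀ x, 0 ≤ g' x) ∧ (∀ x, f' x ≤ f x) ∧ (∀ x, g' x ≤ g x) ∧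
      (∀ x, f' x ≤ E * g' x) ∧ (∀ x, g' x ≤ E * f' x) ∧ ∫ x, g' x ∂ρ = ∫ x, f' x ∂ρ ∧
      m ≤ ∫ x, f' x ∂ρ := by
  rcases le_total (∫ x, f x ∂ρ) (∫ x, g x ∂ρ) with h | h
  · obtain ⟨g', h1, h2, h3, h4, h5, h6, h7⟩ :=
      AC_balance_aux ρ f g E hE hf hg f0 g0 fi gi hfg hgf h
    exact ⟨f, g', hf, h1, fi, h2, f0, h3, fun x => le_rfl, h4, h5, h6, h7, hm1⟩
  · obtain ⟨f', h1, h2, h3, h4, h5, h6, h7⟩ :=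
      AC_balance_aux ρ g f E hE hg hf g0 f0 gi fi hgf hfg h
    exact ⟨f', g, h1, hg, h2, gi, h3, g0, h4, fun x => le_rfl, h6, h5, h7.symm, h7 ▸ hm2⟩

/-- truncation keeps mass `≥ 1 - δ` -/
lemma AC_trunc {Ω : Type*} [MeasurableSpace Ω] (ρ μ ν : Measure Ω) [IsProbabilityMeasure μ]
    [IsProbabilityMeasure ν] (f g : Ω → ℝ) (E δ : ℝ)
    (hf : Measurable f) (hg : Measurable g)
    (fi : Integrable f ρ) (gi : Integrable g ρ)
    (hμ : ∀ S, MeasurableSet S → μ.real S = ∫ x in S, f x ∂ρ)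
    (hν : ∀ S, MeasurableSet S → ν.real S = ∫ x in S, g x ∂ρ)
    (h : ∀ S, MeasurableSet S → μ.real S ≤ E * ν.real S + δ) :
    1 - δ ≤ ∫ x, min (f x) (E * g x) ∂ρ := by
  have hS : MeasurableSet {x | E * g x < f x} := measurableSet_lt (by fun_prop) hf
  set S := {x | E * g x < f x} with hSd
  have i : Integrable (fun x => min (f x) (E * g x)) ρ := fi.inf (gi.const_mul E)
  rw [← integral_add_compl hS i]
  have e1 : ∫ x in S, min (f x) (E * g x) ∂ρ = ∫ x in S, E * g x ∂ρ :=
    setIntegral_congr_fun hS fun x hx => min_eq_right (le_of_lt hx)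
  have e2 : ∫ x in Sᶜ, min (f x) (E * g x) ∂ρ = ∫ x in Sᶜ, f x ∂ρ :=
    setIntegral_congr_fun hS.compl fun x hx => min_eq_left (not_lt.1 hx)
  rw [e1, e2, integral_const_mul, ← hν S hS, ← hμ _ hS.compl, probReal_compl_eq_one_sub hS]
  linarith [h S hS]

lemma AC_decomp {Ω : Type*} [MeasurableSpace Ω] (μ ν : Measure Ω) [IsProbabilityMeasure μ]
    [IsProbabilityMeasure ν] (ε δ : ℝ) (hε : 0 ≤ ε) (hδ : 0 ≤ δ) (hδ1 : δ < 1)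
    (h1 : ∀ S, MeasurableSet S → μ.real S ≤ Real.exp ε * ν.real S + δ)
    (h2 : ∀ S, MeasurableSet S → ν.real S ≤ Real.exp ε * μ.real S + δ) :
    ∃ (μ' ν' : Measure Ω) (L : Ω → ℝ), IsProbabilityMeasure μ' ∧ IsProbabilityMeasure ν' ∧
      Measurable L ∧ (∀ x, |L x| ≤ ε) ∧
      μ' = ν'.withDensity (fun x => ENNReal.ofReal (Real.exp (L x))) ∧
      ENNReal.ofReal (1 - δ) • μ' ≤ μ ∧ ENNReal.ofReal (1 - δ) • ν' ≤ ν := by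
  set ρ := μ + ν with hρ
  set E := Real.exp ε with hE
  have E1 : 1 ≤ E := Real.one_le_exp hε
  have hac : ∀ τ : Measure Ω, IsProbabilityMeasure τ → τ ≤ ρ → ∃ f : Ω → ℝ, Measurable f ∧
      (∀ x, 0 ≤ f x) ∧ Integrable f ρ ∧ (∀ S, MeasurableSet S → τ.real S = ∫ x in S, f x ∂ρ) ∧
      τ = ρ.withDensity (fun x => ENNReal.ofReal (f x)) := by
    intro τ hτ hle
    have ac : τ ≪ ρ := Measure.absolutelyContinuous_of_le hle
    refine ⟨fun x => (τ.rnDeriv ρ x).toReal, by fun_prop, fun x => ENNReal.toReal_nonneg,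
      Measure.integrable_toReal_rnDeriv, fun S hS => (Measure.setIntegral_toReal_rnDeriv ac S).symm, ?_⟩
    conv_lhs => rw [← Measure.withDensity_rnDeriv_eq τ ρ ac]
    apply withDensity_congr_ae
    filter_upwards [Measure.rnDeriv_lt_top τ ρ] with x hx
    rw [ENNReal.ofReal_toReal hx.ne]
  obtain ⟨f, hf, f0, fi, hfS, hfd⟩ := hac μ inferInstance (Measure.le_add_right le_rfl)
  obtain ⟨g, hg, g0, gi, hgS, hgd⟩ := hac ν inferInstance (Measure.le_add_left le_rfl)
  obtain ⟨f', g', mf, mg, fi', gi', f0', g0', ff, gg, hfg, hgf, hgf', hm⟩ :=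
    AC_balance ρ (fun x => min (f x) (E * g x)) (fun x => min (g x) (E * f x)) E E1
      (by fun_prop) (by fun_prop)
      (fun x => le_min (f0 x) (by have := g0 x; positivity))
      (fun x => le_min (g0 x) (by have := f0 x; positivity))
      (fi.inf (gi.const_mul E)) (gi.inf (fi.const_mul E))
      (fun x => by
        rw [mul_min_of_nonneg _ _ (by linarith)]
        refine le_min (min_le_right _ _) ((min_le_left _ _).trans ?_)
        have := f0 x
        have h3 : f x ≤ E * f x := le_mul_of_one_le_left this E1
        exact h3.trans (le_mul_of_one_le_left (this.trans h3) E1))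
      (fun x => by
        rw [mul_min_of_nonneg _ _ (by linarith)]
        refine le_min (min_le_right _ _) ((min_le_left _ _).trans ?_)
        have := g0 x
        have h3 : g x ≤ E * g x := le_mul_of_one_le_left this E1
        exact h3.trans (le_mul_of_one_le_left (this.trans h3) E1))
      (1 - δ) (AC_trunc ρ μ ν f g E δ hf hg fi gi hfS hgS h1)
      (AC_trunc ρ ν μ g f E δ hg hf gi fi hgS hfS h2)
  set m := ∫ x, f' x ∂ρ with hmd
  have m0 : 0 < m := by linarith
  have prob : ∀ k : Ω → ℝ, (∀ x, 0 ≤ k x) → Integrable k ρ → ∫ x, k x ∂ρ = m →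
      IsProbabilityMeasure (ρ.withDensity (fun x => ENNReal.ofReal (k x / m))) := by
    intro k k0 ki km
    constructor
    rw [withDensity_apply _ MeasurableSet.univ, Measure.restrict_univ,
      ← ofReal_integral_eq_lintegral_ofReal (ki.div_const m)
        (Filter.Eventually.of_forall fun x => div_nonneg (k0 x) m0.le), integral_div, km,
        div_self m0.ne', ENNReal.ofReal_one]
  have sub : ∀ (k l : Ω → ℝ), Measurable k → (∀ x, 0 ≤ k x) → (∀ x, k x ≤ l x) →
      ENNReal.ofReal (1 - δ) • ρ.withDensity (fun x => ENNReal.ofReal (k x / m)) ≤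
        ρ.withDensity (fun x => ENNReal.ofReal (l x)) := by
    intro k l mk k0 kl
    rw [← withDensity_smul _ (by fun_prop)]
    apply withDensity_mono
    refine Filter.Eventually.of_forall fun x => ?_
    simp only [Pi.smul_apply, smul_eq_mul]
    rw [← ENNReal.ofReal_mul (by linarith)]
    apply ENNReal.ofReal_le_ofReal
    refine le_trans ?_ (kl x)
    rw [← mul_div_assoc, div_le_iff₀ m0]
    nlinarith [k0 x]
  refine ⟨ρ.withDensity (fun x => ENNReal.ofReal (f' x / m)),
    ρ.withDensity (fun x => ENNReal.ofReal (g' x / m)), fun x => Real.log (f' x / g' x),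
    prob f' f0' fi' rfl, prob g' g0' gi' hgf', by fun_prop, ?_, ?_, ?_, ?_⟩
  · intro x
    rcases (g0' x).eq_or_lt with hz | hz
    · simp [← hz, hε]
    · have fz : 0 < f' x := by
        by_contra hc
        have : f' x = 0 := le_antisymm (not_lt.1 hc) (f0' x)
        have := hgf x
        nlinarith
      rw [abs_le]
      constructor
      · rw [Real.le_log_iff_exp_le (by positivity), Real.exp_neg, le_div_iff₀ hz,
          inv_mul_le_iff₀ (Real.exp_pos _)]
        exact hgf x
      · rw [Real.log_le_iff_le_exp (by positivity), div_le_iff₀ hz]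
        exact hfg x
  · rw [← withDensity_mul _ (by fun_prop) (by fun_prop)]
    congr 1
    funext x
    rw [Pi.mul_apply, ← ENNReal.ofReal_mul (div_nonneg (g0' x) m0.le)]
    congr 1
    rcases (g0' x).eq_or_lt with hz | hz
    · have : f' x = 0 := le_antisymm (by have := hfg x; rw [← hz] at this; simpa using this) (f0' x)
      simp [← hz, this]
    · have fz : 0 < f' x := by
        by_contra hc
        have : f' x = 0 := le_antisymm (not_lt.1 hc) (f0' x)
        have := hgf x
        nlinarith
      rw [Real.exp_log (by positivity)]
      field_simp
  · conv_rhs => rw [hfd]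
    exact sub f' f mf f0' (fun x => (ff x).trans (min_le_left _ _))
  · conv_rhs => rw [hgd]
    exact sub g' g mg g0' (fun x => (gg x).trans (min_le_left _ _))

lemma AC_pure {n : ℕ} (hn : 0 < n) {Ω : Fin n → Type*} [∀ t, MeasurableSpace (Ω t)]
    (μ ν : ∀ t, Measure (Ω t)) [∀ t, IsProbabilityMeasure (μ t)]
    [∀ t, IsProbabilityMeasure (ν t)] (ε δ' : ℝ) (hε : 0 ≤ ε) (h0 : 0 < δ') (h1 : δ' < 1)
    (L : ∀ t, Ω t → ℝ) (hL : ∀ t, Measurable (L t)) (hb : ∀ t x, |L t x| ≤ ε)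
    (h : ∀ t, μ t = (ν t).withDensity (fun x => ENNReal.ofReal (Real.exp (L t x))))
    (S : Set (∀ t, Ω t)) (hS : MeasurableSet S) :
    (Measure.pi μ).real S ≤ Real.exp (Real.sqrt (2 * n * Real.log (1 / δ')) * ε +
              n * ε * (Real.exp ε - 1)) * (Measure.pi ν).real S + δ' := by
  set u := Real.sqrt (2 * n * Real.log (1 / δ')) * ε with hu
  set K := u + n * ε * (Real.exp ε - 1) with hK
  have hlog : 0 < Real.log (1 / δ') := Real.log_pos (by rw [lt_div_iff₀ h0]; linarith)
  have n0 : (0 : ℝ) < n := by exact_mod_cast hn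
  have hpi := AC_pi_withDensity μ ν (fun t x => ENNReal.ofReal (Real.exp (L t x)))
    (fun t => by have := hL t; fun_prop) h
  have hsm : Measurable (fun x : ∀ t, Ω t => ∑ t, L t (x t)) :=
    Finset.measurable_sum _ fun t _ => (hL t).comp (measurable_pi_apply t)
  have hdens : (fun x : ∀ t, Ω t => ∏ t, ENNReal.ofReal (Real.exp (L t (x t))))
      = fun x => ENNReal.ofReal (Real.exp (∑ t, L t (x t))) := by
    funext x
    rw [Real.exp_sum, ENNReal.ofReal_prod_of_nonneg fun t _ => (Real.exp_pos _).le]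
  rw [hdens] at hpi
  -- good part
  have good : ∀ A : Set (∀ t, Ω t), MeasurableSet A → (∀ x ∈ A, ∑ t, L t (x t) ≤ K) →
      (Measure.pi μ).real A ≤ Real.exp K * (Measure.pi ν).real A := by
    intro A hA hx
    have : Measure.pi μ A ≤ ENNReal.ofReal (Real.exp K) * Measure.pi ν A := by
      rw [hpi, withDensity_apply _ hA, ← setLIntegral_const]
      exact setLIntegral_mono measurable_const fun x hxA =>
        ENNReal.ofReal_le_ofReal (Real.exp_le_exp.2 (hx x hxA))
    have := ENNReal.toReal_mono (by finiteness) this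
    rw [ENNReal.toReal_mul, ENNReal.toReal_ofReal (Real.exp_pos _).le] at this
    exact this
  rcases hε.eq_or_lt with hz | hεp
  · have := good S hS (fun x _ => by
      have : ∀ t, L t (x t) = 0 := fun t => by
        have := hb t (x t); rw [← hz] at this; exact abs_nonpos_iff.1 this
      simp [this, hK, hu, ← hz])
    linarith
  have tail : (Measure.pi μ).real {x | K ≤ ∑ t, L t (x t)} ≤ δ' := by
    have ind := ProbabilityTheory.iIndepFun_pi (μ := μ)
      (X := fun t x => L t x - ∫ y, L t y ∂(μ t)) (fun t => by have := hL t; fun_prop)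
    have sg : ∀ t ∈ (Finset.univ : Finset (Fin n)), ProbabilityTheory.HasSubgaussianMGF
        (fun x : ∀ t, Ω t => L t (x t) - ∫ y, L t y ∂(μ t))
        ((‖ε - (-ε)‖₊ / 2) ^ 2) (Measure.pi μ) := by
      intro t _
      have := ProbabilityTheory.hasSubgaussianMGF_of_mem_Icc (μ := Measure.pi μ)
        (X := fun x : ∀ t, Ω t => L t (x t)) (a := -ε) (b := ε)
        ((hL t).comp (measurable_pi_apply t)).aemeasurable
        (Filter.Eventually.of_forall fun x => abs_le.1 (hb t (x t)))
      have e : ∫ x, L t (x t) ∂(Measure.pi μ) = ∫ y, L t y ∂(μ t) := by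
        rw [← (measurePreserving_eval μ t).map_eq]
        rw [integral_map (measurable_pi_apply t).aemeasurable (hL t).aestronglyMeasurable]
      rw [e] at this
      exact this
    have u0 : 0 ≤ u := by positivity
    have hoef := ProbabilityTheory.HasSubgaussianMGF.measure_sum_ge_le_of_iIndepFun ind sg u0
    have hsub : {x : ∀ t, Ω t | K ≤ ∑ t, L t (x t)} ⊆
        {x | u ≤ ∑ t, (L t (x t) - ∫ y, L t y ∂(μ t))} := by
      intro x hx
      simp only [Set.mem_ofPred_eq] at hx ⊢
      rw [Finset.sum_sub_distrib]
      have : ∑ t, ∫ y, L t y ∂(μ t) ≤ ∑ t : Fin n, ε * (Real.exp ε - 1) :=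
        Finset.sum_le_sum fun t _ => AC_mean (μ t) (ν t) ε (L t) (hL t) (hb t) (h t)
      simp only [Finset.sum_const, Finset.card_univ, Fintype.card_fin, nsmul_eq_mul] at this
      rw [hK] at hx
      linarith
    refine (measureReal_mono hsub).trans (hoef.trans_eq ?_)
    have hc : ((∑ t : Fin n, ((‖ε - (-ε)‖₊ / 2) ^ 2 : NNReal) : NNReal) : ℝ) = n * ε ^ 2 := by
      have : |ε + ε| = 2 * ε := by rw [abs_of_pos (by linarith)]; ring
      simp [this]
    have hu2 : u ^ 2 = 2 * n * Real.log (1 / δ') * ε ^ 2 := by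
      rw [hu, mul_pow, Real.sq_sqrt (by positivity)]
    have : -u ^ 2 / (2 * ((∑ t : Fin n, ((‖ε - (-ε)‖₊ / 2) ^ 2 : NNReal) : NNReal) : ℝ))
        = Real.log δ' := by
      rw [hc, hu2, one_div, Real.log_inv]
      field_simp
    rw [this, Real.exp_log h0]
  have hT : MeasurableSet {x : ∀ t, Ω t | K ≤ ∑ t, L t (x t)} :=
    measurableSet_le measurable_const hsm
  have g1 := good (S \ {x : ∀ t, Ω t | K ≤ ∑ t, L t (x t)}) (hS.diff hT)
    (fun x hx => (not_le.1 hx.2).le)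
  have g2 : (Measure.pi ν).real (S \ {x : ∀ t, Ω t | K ≤ ∑ t, L t (x t)})
      ≤ (Measure.pi ν).real S := measureReal_mono Set.sdiff_subset
  have g3 : (Measure.pi μ).real S ≤ (Measure.pi μ).real (S \ {x | K ≤ ∑ t, L t (x t)})
      + (Measure.pi μ).real {x | K ≤ ∑ t, L t (x t)} := by
    refine (measureReal_mono ?_).trans (measureReal_union_le _ _)
    intro x hx
    by_cases hc : K ≤ ∑ t, L t (x t)
    · exact Or.inr hc
    · exact Or.inl ⟨hx, hc⟩
  have := mul_le_mul_of_nonneg_left g2 (Real.exp_pos K).le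
  linarith

/-- **Advanced composition for multi-round fairness verification.**
If for each round `t` the pair `(μ_t, ν_t)` satisfies the two-sided
`(ε₀, δ₀)`-indistinguishability inequality, then the product measures are
`(ε_T, T·δ₀ + δ')`-indistinguishable with
`ε_T = √(2T ln(1/δ')) ε₀ + T ε₀ (e^{ε₀} − 1)`. -/
theorem advanced_composition_indistinguishability
    (ε₀ δ₀ : ℝ) (hε₀ : 0 ≤ ε₀) (hδ₀ : 0 ≤ δ₀)
    (T : ℕ) (hT : 0 < T) (δ' : ℝ) (hδ'0 : 0 < δ') (hδ'1 : δ' < 1)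
    (Ω : Fin T → Type*) [∀ t, MeasurableSpace (Ω t)]
    (μ ν : ∀ t, Measure (Ω t))
    [∀ t, IsProbabilityMeasure (μ t)] [∀ t, IsProbabilityMeasure (ν t)]
    (h : ∀ t, ∀ S : Set (Ω t), MeasurableSet S →
      μ t S ≤ ENNReal.ofReal (Real.exp ε₀) * ν t S + ENNReal.ofReal δ₀ ∧
      ν t S ≤ ENNReal.ofReal (Real.exp ε₀) * μ t S + ENNReal.ofReal δ₀) :
    ∀ S : Set (∀ t, Ω t), MeasurableSet S →
      Measure.pi μ S ≤
        ENNReal.ofReal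
            (Real.exp (Real.sqrt (2 * T * Real.log (1 / δ')) * ε₀ +
              T * ε₀ * (Real.exp ε₀ - 1))) * Measure.pi ν S
          + ENNReal.ofReal (T * δ₀ + δ') := by
  intro S hS
  have T1 : (1 : ℝ) ≤ T := by exact_mod_cast hT
  set K := Real.sqrt (2 * T * Real.log (1 / δ')) * ε₀ + T * ε₀ * (Real.exp ε₀ - 1) with hK
  suffices hmain : (Measure.pi μ).real S
      ≤ Real.exp K * (Measure.pi ν).real S + (T * δ₀ + δ') by
    have h1 := ENNReal.ofReal_le_ofReal hmain
    rw [ENNReal.ofReal_add (by positivity) (by positivity),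
      ENNReal.ofReal_mul (Real.exp_pos _).le, ofReal_measureReal, ofReal_measureReal] at h1
    exact h1
  rcases le_or_gt 1 δ₀ with hd | hd
  · have a1 : (Measure.pi μ).real S ≤ 1 := measureReal_le_one
    have a2 : 0 ≤ Real.exp K * (Measure.pi ν).real S := by positivity
    nlinarith
  have conv : ∀ (t : Fin T) (α β : Measure (Ω t)) [IsProbabilityMeasure α]
      [IsProbabilityMeasure β] (A : Set (Ω t)),
      α A ≤ ENNReal.ofReal (Real.exp ε₀) * β A + ENNReal.ofReal δ₀ →
      α.real A ≤ Real.exp ε₀ * β.real A + δ₀ := by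
    intro t α β _ _ A hA
    have := ENNReal.toReal_mono (by finiteness) hA
    rw [ENNReal.toReal_add (by finiteness) (by finiteness), ENNReal.toReal_mul,
      ENNReal.toReal_ofReal (Real.exp_pos _).le, ENNReal.toReal_ofReal hδ₀] at this
    exact this
  choose μ' ν' L pμ pν hL hb hden hμ hν using fun t =>
    AC_decomp (μ t) (ν t) ε₀ δ₀ hε₀ hδ₀ hd
      (fun A hA => conv t _ _ A (h t A hA).1) (fun A hA => conv t _ _ A (h t A hA).2)
  have pure := AC_pure hT μ' ν' ε₀ δ' hε₀ hδ'0 hδ'1 L hL hb hden S hS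
  rw [← hK] at pure
  have d0 : 0 ≤ 1 - δ₀ := by linarith
  have real_le : ∀ (α β : Measure (∀ t, Ω t)) [IsProbabilityMeasure α] [IsProbabilityMeasure β]
      (A : Set (∀ t, Ω t)), (ENNReal.ofReal (1 - δ₀) ^ T) • α ≤ β →
      (1 - δ₀) ^ T * α.real A ≤ β.real A := by
    intro α β _ _ A hA
    have h2 := hA A
    rw [Measure.smul_apply, smul_eq_mul] at h2
    have := ENNReal.toReal_mono (by finiteness) h2
    rw [ENNReal.toReal_mul, ENNReal.toReal_pow, ENNReal.toReal_ofReal d0] at this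
    exact this
  have r1 := real_le _ _ Sᶜ (AC_le_pi μ μ' _ hμ)
  have r2 := real_le _ _ S (AC_le_pi ν ν' _ hν)
  rw [probReal_compl_eq_one_sub hS, probReal_compl_eq_one_sub hS] at r1
  have C0 : 0 ≤ (1 - δ₀) ^ T := by positivity
  have C1 : (1 - δ₀) ^ T ≤ 1 := pow_le_one₀ d0 (by linarith)
  have C2 : 1 - T * δ₀ ≤ (1 - δ₀) ^ T := by
    have := one_add_mul_le_pow (a := -δ₀) (by linarith) T
    rw [← sub_eq_add_neg] at this
    linarith
  have s1 := mul_le_mul_of_nonneg_left pure C0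
  have s2 := mul_le_mul_of_nonneg_left r2 (Real.exp_pos K).le
  have s3 := mul_le_mul_of_nonneg_right C1 hδ'0.le
  nlinarith
end

section
/- Let ε ≥ 0 and let μ₀ and μ₁ be probability measures on a measurable space Ω such that for every measurable set S ⊆ Ω, μ₁(S) ≤ e^ε · μ₀(S). Then for every measurable set S ⊆ Ω (interpreting the attacker as guessing attribute value 1 exactly when the observation lies in S), the attacker's success probability under a uniform prior satisfies (μ₀(Ω \ S) + μ₁(S)) / 2 ≤ 1 − e^{−ε}/2 ≤ 1/2 + ε/2. (This is the attribute inference defense bound: if the released fairness-metric history is ε-indistinguishable with respect to one participant's protected attribute, then any attribute inference attack succeeds with probability at most 1/2 + ε/2.) -/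
open MeasureTheory

/-- **Attribute inference defense bound.**
If `μ₁(S) ≤ e^ε μ₀(S)` for every measurable `S`, then for any (deterministic,
measurable) attacker identified with the set `S` of observations on which it
guesses attribute value `1`, the success probability under a uniform prior is
at most `1 − e^{−ε}/2 ≤ 1/2 + ε/2`. -/
theorem attribute_inference_defense_bound
    {Ω : Type*} [MeasurableSpace Ω] (μ₀ μ₁ : Measure Ω)
    [IsProbabilityMeasure μ₀] [IsProbabilityMeasure μ₁]
    (ε : ℝ) (hε : 0 ≤ ε)
    (h : ∀ S : Set Ω, MeasurableSet S → μ₁ S ≤ ENNReal.ofReal (Real.exp ε) * μ₀ S) :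
    ∀ S : Set Ω, MeasurableSet S →
      ((μ₀ Sᶜ).toReal + (μ₁ S).toReal) / 2 ≤ 1 - Real.exp (-ε) / 2 ∧
      1 - Real.exp (-ε) / 2 ≤ 1 / 2 + ε / 2 := by
  intro S hS
  have h2 : 1 - ε ≤ Real.exp (-ε) := by
    have := Real.add_one_le_exp (-ε)
    linarith
  refine ⟨?_, by linarith⟩
  have hc : (μ₀ Sᶜ).toReal = 1 - (μ₀ S).toReal := probReal_compl_eq_one_sub hS
  have hq : (μ₁ S).toReal ≤ 1 := measureReal_le_one
  have hle : (μ₁ S).toReal ≤ Real.exp ε * (μ₀ S).toReal := by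
    have := ENNReal.toReal_mono
      (ENNReal.mul_ne_top ENNReal.ofReal_ne_top (measure_ne_top μ₀ S)) (h S hS)
    rwa [ENNReal.toReal_mul, ENNReal.toReal_ofReal (Real.exp_pos ε).le] at this
  have hp : Real.exp (-ε) * (μ₁ S).toReal ≤ (μ₀ S).toReal := by
    have := mul_le_mul_of_nonneg_left hle (Real.exp_pos (-ε)).le
    rwa [← mul_assoc, ← Real.exp_add, neg_add_cancel, Real.exp_zero, one_mul] at this
  have he : Real.exp (-ε) ≤ 1 := Real.exp_le_one_iff.mpr (by linarith)
  rw [hc]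
  nlinarith [mul_nonneg (sub_nonneg.mpr hq) (sub_nonneg.mpr he)]
end

section
/- Let S₀, S₁ ≥ 0 be real numbers with n_a := S₀ + S₁ > 0, and let e₀, e₁ be real numbers with |e₀| ≤ B and |e₁| ≤ B for some B ≥ 0 with 4B ≤ n_a. Then n_a + e₀ + e₁ > 0 and |(S₁ + e₁)/(n_a + e₀ + e₁) − S₁/n_a| ≤ 6B/n_a. (Deterministic perturbation bound for the group positive-prediction rate: when each of the two counts defining a group's rate is perturbed by noise of magnitude at most B, the estimated rate P̂_a = S̃^{(a,1)}/(S̃^{(a,0)} + S̃^{(a,1)}) deviates from the true rate P_a = S^{(a,1)}/(S^{(a,0)} + S^{(a,1)}) by at most 6B/n_a.) -/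
/-- **Perturbation bound for a group's positive-prediction rate.**
If the two counts defining a group rate are each perturbed by noise of
magnitude at most `B` with `4B ≤ n_a = S₀ + S₁`, then the perturbed
denominator stays positive and the estimated rate deviates from the true
rate by at most `6B/n_a`. -/
theorem noised_rate_perturbation_bound
    (S₀ S₁ e₀ e₁ B : ℝ) (hS₀ : 0 ≤ S₀) (hS₁ : 0 ≤ S₁)
    (hn : 0 < S₀ + S₁) (hB : 0 ≤ B) (he₀ : |e₀| ≤ B) (he₁ : |e₁| ≤ B)
    (h4B : 4 * B ≤ S₀ + S₁) :
    0 < S₀ + S₁ + e₀ + e₁ ∧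
    |(S₁ + e₁) / (S₀ + S₁ + e₀ + e₁) - S₁ / (S₀ + S₁)| ≤ 6 * B / (S₀ + S₁) := by
  obtain ⟨a0, b0⟩ := abs_le.mp he₀
  obtain ⟨a1, b1⟩ := abs_le.mp he₁
  have hD : 0 < S₀ + S₁ + e₀ + e₁ := by linarith
  have hD2 : S₀ + S₁ ≤ 2 * (S₀ + S₁ + e₀ + e₁) := by linarith
  refine ⟨hD, ?_⟩
  have key : (S₁ + e₁) / (S₀ + S₁ + e₀ + e₁) - S₁ / (S₀ + S₁)
      = ((S₀ * e₁ - S₁ * e₀) / (S₀ + S₁ + e₀ + e₁)) / (S₀ + S₁) := by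
    have h1 := hD.ne'
    have h2 := hn.ne'
    field_simp
    ring
  rw [key, abs_div, abs_of_pos hn]
  refine div_le_div_of_nonneg_right ?_ hn.le
  rw [abs_div, abs_of_pos hD, div_le_iff₀ hD]
  have h3 := mul_le_mul_of_nonneg_left hD2 hB
  have h4 := mul_nonneg hB hD.le
  have p1 := mul_le_mul_of_nonneg_left a1 hS₀
  have p2 := mul_le_mul_of_nonneg_left b1 hS₀
  have p3 := mul_le_mul_of_nonneg_left a0 hS₁
  have p4 := mul_le_mul_of_nonneg_left b0 hS₁
  rw [abs_le]
  constructor <;> linarith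
end

section
/- For a ∈ {0, 1}, let S_a⁰, S_a¹ ≥ 0 be real numbers with n_a := S_a⁰ + S_a¹ > 0, let P_a = S_a¹/n_a, and let e_a⁰, e_a¹ be real numbers with |e_a⁰| ≤ B and |e_a¹| ≤ B for some B ≥ 0 with 4B ≤ min{n₀, n₁}. Define P̂_a = (S_a¹ + e_a¹)/(n_a + e_a⁰ + e_a¹). Then the estimated demographic parity violation satisfies | |P̂₀ − P̂₁| − |P₀ − P₁| | ≤ 12B/min{n₀, n₁}. (This is the deterministic accuracy bound for the encrypted, noised demographic parity verification: the verified fairness metric deviates from the true demographic parity violation by at most a quantity inversely proportional to the size of the smaller protected group.) -/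
theorem group_rate_error (p q u v B m : ℝ) (hp : 0 ≤ p) (hq : 0 ≤ q) (hn : 0 < p + q)
    (hB : 0 ≤ B) (hu : |u| ≤ B) (hv : |v| ≤ B) (hm : 0 < m) (hmn : m ≤ p + q)
    (h4 : 4 * B ≤ m) :
    |(q + v) / (p + q + u + v) - q / (p + q)| ≤ 6 * B / m := by
  obtain ⟨hu1, hu2⟩ := abs_le.mp hu
  obtain ⟨hv1, hv2⟩ := abs_le.mp hv
  have hd : (p + q) / 2 ≤ p + q + u + v := by linarith
  have hd0 : 0 < p + q + u + v := by linarith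
  have key : (q + v) / (p + q + u + v) - q / (p + q)
      = (v * p - u * q) / ((p + q + u + v) * (p + q)) := by
    field_simp
    ring
  have hnum : |v * p - u * q| ≤ B * (p + q) := by
    rw [abs_le]
    constructor <;> nlinarith [mul_le_mul_of_nonneg_right hv2 hp,
      mul_le_mul_of_nonneg_right hv1 hp, mul_le_mul_of_nonneg_right hu1 hq,
      mul_le_mul_of_nonneg_right hu2 hq]
  rw [key, abs_div, abs_of_pos (mul_pos hd0 hn)]
  calc |v * p - u * q| / ((p + q + u + v) * (p + q))
      ≤ B * (p + q) / ((p + q + u + v) * (p + q)) := by gcongr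
    _ = B / (p + q + u + v) := by field_simp
    _ ≤ 6 * B / m := by
      rw [div_le_div_iff₀ hd0 hm]
      have h1 : m ≤ 6 * (p + q + u + v) := by linarith
      nlinarith [mul_le_mul_of_nonneg_left h1 hB]

/-- **Deterministic accuracy bound for noised demographic parity verification.**
For each group `a ∈ {0,1}` with counts `S a y ≥ 0` (`y` the prediction), group
size `n_a = S a 0 + S a 1 > 0`, true rate `P_a = S a 1 / n_a`, and noised rate
`P̂_a = (S a 1 + e a 1) / (n_a + e a 0 + e a 1)` where `|e a y| ≤ B` and
`4B ≤ min{n₀, n₁}`, the estimated demographic parity violation satisfies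
`| |P̂₀ − P̂₁| − |P₀ − P₁| | ≤ 12B / min{n₀, n₁}`. -/
theorem noised_demographic_parity_accuracy
    (S e : Fin 2 → Fin 2 → ℝ) (B : ℝ)
    (hS : ∀ a y, 0 ≤ S a y)
    (hn : ∀ a, 0 < S a 0 + S a 1)
    (hB : 0 ≤ B) (he : ∀ a y, |e a y| ≤ B)
    (h4B : 4 * B ≤ min (S 0 0 + S 0 1) (S 1 0 + S 1 1)) :
    abs (|(S 0 1 + e 0 1) / (S 0 0 + S 0 1 + e 0 0 + e 0 1) -
            (S 1 1 + e 1 1) / (S 1 0 + S 1 1 + e 1 0 + e 1 1)| -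
          |S 0 1 / (S 0 0 + S 0 1) - S 1 1 / (S 1 0 + S 1 1)|) ≤
      12 * B / min (S 0 0 + S 0 1) (S 1 0 + S 1 1) := by
  have hm : 0 < min (S 0 0 + S 0 1) (S 1 0 + S 1 1) := lt_min (hn 0) (hn 1)
  have h0 := group_rate_error (S 0 0) (S 0 1) (e 0 0) (e 0 1) B _ (hS 0 0) (hS 0 1) (hn 0) hB
    (he 0 0) (he 0 1) hm (min_le_left _ _) h4B
  have h1 := group_rate_error (S 1 0) (S 1 1) (e 1 0) (e 1 1) B _ (hS 1 0) (hS 1 1) (hn 1) hB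
    (he 1 0) (he 1 1) hm (min_le_right _ _) h4B
  refine (abs_abs_sub_abs_le_abs_sub _ _).trans ?_
  rw [sub_sub_sub_comm]
  refine (abs_sub _ _).trans ((add_le_add h0 h1).trans (le_of_eq ?_))
  ring
end

section
/- Let σ > 0, let T be a positive integer, let δ' ∈ (0, 1), and let a₁, …, a_T and b₁, …, b_T be real numbers with |a_t − b_t| ≤ 1 for every t. Then the product measures ⊗_{t=1}^{T} Lap(a_t, σ) and ⊗_{t=1}^{T} Lap(b_t, σ) on ℝ^T satisfy: for every measurable set S ⊆ ℝ^T, (⊗_{t=1}^{T} Lap(a_t, σ))(S) ≤ e^{ε_T} · (⊗_{t=1}^{T} Lap(b_t, σ))(S) + δ', where ε_T = √(2T · ln(1/δ'))·(1/σ) + T·(1/σ)·(e^{1/σ} − 1). (Instantiation of the protocol's overall privacy guarantee: T rounds of Laplace-noised release of sensitivity-1 count statistics compose to an (ε_T, δ')-indistinguishable mechanism.) -/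
open MeasureTheory

/-- The Laplace measure on `ℝ` centered at `c` with scale `σ`: the measure with
density `x ↦ (1/(2σ)) · exp (−|x − c|/σ)` with respect to Lebesgue measure. -/
noncomputable def laplaceMeasure (c σ : ℝ) : Measure ℝ :=
  volume.withDensity fun x => ENNReal.ofReal (1 / (2 * σ) * Real.exp (-|x - c| / σ))

/-- total mass one -/
lemma laplaceMeasure_isProb (c σ : ℝ) (hσ : 0 < σ) : IsProbabilityMeasure (laplaceMeasure c σ) := by
  constructor
  have h1 : ∫ x : ℝ, 1 / (2 * σ) * Real.exp (-|x - c| / σ) = 1 := by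
    rw [integral_sub_right_eq_self (fun x : ℝ => 1 / (2 * σ) * Real.exp (-|x| / σ)) c,
      integral_const_mul, integral_comp_abs (f := fun x : ℝ => Real.exp (-x / σ))]
    have h2 := integral_exp_mul_Ioi (a := -(1 / σ)) (by simpa using hσ) 0
    have h3 : ∀ x : ℝ, -x / σ = -(1 / σ) * x := fun x => by ring
    simp_rw [h3, h2]
    simp
    field_simp
  have hi : Integrable (fun x : ℝ => 1 / (2 * σ) * Real.exp (-|x - c| / σ)) := by
    by_contra h
    rw [integral_undef h] at h1
    norm_num at h1
  rw [laplaceMeasure, withDensity_apply _ MeasurableSet.univ, Measure.restrict_univ,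
    ← ofReal_integral_eq_lintegral_ofReal hi (ae_of_all _ fun x => by positivity), h1]
  simp

/-- the privacy loss of one round -/
noncomputable def lapLoss (σ a b x : ℝ) : ℝ := (|x - b| - |x - a|) / σ

lemma measurable_lapLoss (σ a b : ℝ) : Measurable (lapLoss σ a b) := by
  unfold lapLoss
  fun_prop

lemma laplaceMeasure_eq (σ a b : ℝ) :
    laplaceMeasure a σ =
      (laplaceMeasure b σ).withDensity fun x => ENNReal.ofReal (Real.exp (lapLoss σ a b x)) := by
  have hm := measurable_lapLoss σ a b
  unfold laplaceMeasure
  rw [← withDensity_mul _ (by fun_prop) (by fun_prop)]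
  congr 1
  funext x
  rw [Pi.mul_apply, ← ENNReal.ofReal_mul' (Real.exp_nonneg _), mul_assoc, ← Real.exp_add, lapLoss]
  congr 4
  ring

lemma abs_lapLoss_le (σ a b x : ℝ) (hσ : 0 < σ) (hab : |a - b| ≤ 1) :
    |lapLoss σ a b x| ≤ 1 / σ := by
  unfold lapLoss
  rw [abs_div, abs_of_pos hσ]
  gcongr
  calc _ ≤ |(x - b) - (x - a)| := abs_abs_sub_abs_le_abs_sub _ _
    _ = |a - b| := by ring_nf
    _ ≤ 1 := hab

lemma loss_pointwise (ε L : ℝ) (h : |L| ≤ ε) :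
    L ≤ ε * (Real.exp ε - 1) * Real.exp (-L) + (1 - Real.exp (-L)) := by
  have hε : 0 ≤ ε := (abs_nonneg _).trans h
  obtain ⟨h1, h2⟩ := abs_le.1 h
  have key : L * (Real.exp L - 1) ≤ ε * (Real.exp ε - 1) := by
    rcases le_total 0 L with h0 | h0
    · have : Real.exp L ≤ Real.exp ε := Real.exp_le_exp.2 h2
      have h3 : 1 ≤ Real.exp L := Real.one_le_exp h0
      exact mul_le_mul h2 (by linarith) (by linarith) hε
    · have e1 := Real.add_one_le_exp L
      have e2 := Real.add_one_le_exp ε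
      nlinarith
  have e1 := Real.add_one_le_exp L
  have e3 : Real.exp L * Real.exp (-L) = 1 := by rw [← Real.exp_add]; simp
  have e4 := Real.exp_pos (-L)
  have : L * Real.exp L ≤ ε * (Real.exp ε - 1) + (Real.exp L - 1) := by linarith
  have := mul_le_mul_of_nonneg_right this e4.le
  have e5 : L * Real.exp L * Real.exp (-L) = L := by rw [mul_assoc, e3, mul_one]
  nlinarith

lemma integral_exp_neg_lapLoss (σ a b : ℝ) (hσ : 0 < σ) :
    ∫ x, Real.exp (-lapLoss σ a b x) ∂(laplaceMeasure a σ) = 1 := by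
  have hm := measurable_lapLoss σ a b
  have := (laplaceMeasure_isProb b σ hσ).measure_univ
  rw [laplaceMeasure_eq σ b a, withDensity_apply _ MeasurableSet.univ, Measure.restrict_univ] at this
  rw [integral_eq_lintegral_of_nonneg_ae (ae_of_all _ fun x => (Real.exp_pos _).le)
    (by fun_prop)]
  have h : ∀ x, -lapLoss σ a b x = lapLoss σ b a x := fun x => by unfold lapLoss; ring
  simp_rw [h, this]
  simp

lemma integral_lapLoss_le (σ a b : ℝ) (hσ : 0 < σ) (hab : |a - b| ≤ 1) :
    ∫ x, lapLoss σ a b x ∂(laplaceMeasure a σ) ≤ 1 / σ * (Real.exp (1 / σ) - 1) := by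
  have hm := measurable_lapLoss σ a b
  have := laplaceMeasure_isProb a σ hσ
  have h1 := integral_exp_neg_lapLoss σ a b hσ
  have hi : Integrable (fun x => Real.exp (-lapLoss σ a b x)) (laplaceMeasure a σ) := by
    by_contra h
    rw [integral_undef h] at h1
    norm_num at h1
  have hi2 : Integrable (lapLoss σ a b) (laplaceMeasure a σ) :=
    Integrable.of_mem_Icc (-(1 / σ)) (1 / σ) hm.aemeasurable
      (ae_of_all _ fun x => abs_le.1 (abs_lapLoss_le σ a b x hσ hab))
  refine (integral_mono hi2 ((hi.const_mul _).add ((integrable_const 1).sub hi))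
    fun x => loss_pointwise (1 / σ) _ (abs_lapLoss_le σ a b x hσ hab)).trans ?_
  have hi3 : Integrable (fun x => 1 - Real.exp (-lapLoss σ a b x)) (laplaceMeasure a σ) :=
    (integrable_const 1).sub hi
  simp only [Pi.add_apply, Pi.sub_apply]
  rw [integral_add (hi.const_mul _) hi3, integral_const_mul,
    integral_sub (integrable_const 1) hi, h1]
  simp

lemma pi_withDensity_eq {T : ℕ} (μ : Fin T → Measure ℝ) [∀ t, IsProbabilityMeasure (μ t)]
    (f : Fin T → ℝ → ENNReal) (hf : ∀ t, Measurable (f t))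
    [∀ t, IsProbabilityMeasure ((μ t).withDensity (f t))] :
    Measure.pi (fun t => (μ t).withDensity (f t)) =
      (Measure.pi μ).withDensity (fun x => ∏ t, f t (x t)) := by
  refine Measure.pi_eq fun s hs => ?_
  rw [withDensity_apply _ (MeasurableSet.univ_pi hs), ← lintegral_indicator (MeasurableSet.univ_pi hs)]
  have h1 : (Set.univ.pi s).indicator (fun x : Fin T → ℝ => ∏ t, f t (x t)) =
      fun x => ∏ t, (s t).indicator (f t) (x t) := by
    funext x
    by_cases hx : x ∈ Set.univ.pi s
    · rw [Set.indicator_of_mem hx]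
      exact Finset.prod_congr rfl fun t _ => (Set.indicator_of_mem (hx t trivial) _).symm
    · rw [Set.indicator_of_notMem hx]
      simp only [Set.mem_pi, Set.mem_univ, true_imp_iff, not_forall] at hx
      obtain ⟨t, ht⟩ := hx
      exact (Finset.prod_eq_zero (Finset.mem_univ t) (Set.indicator_of_notMem ht _)).symm
  have hm : ∀ t, Measurable ((s t).indicator (f t)) := fun t => (hf t).indicator (hs t)
  rw [h1, ProbabilityTheory.lintegral_prod_eq_prod_lintegral_of_indepFun Finset.univ
    (fun t (x : Fin T → ℝ) => (s t).indicator (f t) (x t))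
    (ProbabilityTheory.iIndepFun_pi fun t => (hm t).aemeasurable) fun t => (hm t).comp (measurable_pi_apply t)]
  refine Finset.prod_congr rfl fun t _ => ?_
  rw [withDensity_apply _ (hs t), ← lintegral_indicator (hs t)]
  exact (measurePreserving_eval μ t).lintegral_comp (hm t)

/-- **Overall privacy guarantee for `T` rounds of Laplace-noised releases.**
If `|a_t − b_t| ≤ 1` for every `t`, then the product measures
`⊗_t Lap(a_t, σ)` and `⊗_t Lap(b_t, σ)` on `ℝ^T` satisfy
`(⊗_t Lap(a_t, σ))(S) ≤ e^{ε_T} (⊗_t Lap(b_t, σ))(S) + δ'` for every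
measurable `S`, where
`ε_T = √(2T ln(1/δ'))·(1/σ) + T·(1/σ)·(e^{1/σ} − 1)`. -/
theorem laplace_rounds_advanced_composition
    (σ : ℝ) (hσ : 0 < σ) (T : ℕ) (hT : 0 < T) (δ' : ℝ) (hδ'0 : 0 < δ') (hδ'1 : δ' < 1)
    (a b : Fin T → ℝ) (hab : ∀ t, |a t - b t| ≤ 1) :
    ∀ S : Set (Fin T → ℝ), MeasurableSet S →
      Measure.pi (fun t => laplaceMeasure (a t) σ) S ≤
        ENNReal.ofReal
            (Real.exp (Real.sqrt (2 * T * Real.log (1 / δ')) * (1 / σ) +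
              T * (1 / σ) * (Real.exp (1 / σ) - 1))) *
            Measure.pi (fun t => laplaceMeasure (b t) σ) S
          + ENNReal.ofReal δ' := by
  intro S hS
  have hP : ∀ t, IsProbabilityMeasure (laplaceMeasure (a t) σ) :=
    fun t => laplaceMeasure_isProb _ _ hσ
  have hQ : ∀ t, IsProbabilityMeasure (laplaceMeasure (b t) σ) :=
    fun t => laplaceMeasure_isProb _ _ hσ
  have hm := fun t => measurable_lapLoss σ (a t) (b t)
  set s : ℝ := Real.sqrt (2 * T * Real.log (1 / δ')) * (1 / σ) with hs
  set E : ℝ := s + T * (1 / σ) * (Real.exp (1 / σ) - 1) with hE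
  set P := Measure.pi (fun t => laplaceMeasure (a t) σ) with hPdef
  set Q := Measure.pi (fun t => laplaceMeasure (b t) σ) with hQdef
  have hPQ : P = Q.withDensity fun x =>
      ENNReal.ofReal (Real.exp (∑ t, lapLoss σ (a t) (b t) (x t))) := by
    have h1 : (fun t => laplaceMeasure (a t) σ) = fun t => (laplaceMeasure (b t) σ).withDensity
        fun x => ENNReal.ofReal (Real.exp (lapLoss σ (a t) (b t) x)) :=
      funext fun t => laplaceMeasure_eq σ (a t) (b t)
    have : ∀ t, IsProbabilityMeasure ((laplaceMeasure (b t) σ).withDensity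
        fun x => ENNReal.ofReal (Real.exp (lapLoss σ (a t) (b t) x))) := fun t => by
      rw [← laplaceMeasure_eq]; exact hP t
    rw [hPdef, h1, pi_withDensity_eq (fun t => laplaceMeasure (b t) σ)
      (fun t x => ENNReal.ofReal (Real.exp (lapLoss σ (a t) (b t) x)))
      (fun t => by have := hm t; fun_prop)]
    congr 1
    funext x
    rw [Real.exp_sum, ENNReal.ofReal_prod_of_nonneg fun t _ => (Real.exp_pos _).le]
  have hmsum : Measurable fun x : Fin T → ℝ => ∑ t, lapLoss σ (a t) (b t) (x t) :=
    Finset.measurable_sum _ fun t _ => (hm t).comp (measurable_pi_apply t)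
  set B : Set (Fin T → ℝ) := {x | E ≤ ∑ t, lapLoss σ (a t) (b t) (x t)} with hB
  have hBm : MeasurableSet B := measurableSet_le measurable_const hmsum
  have hgood : P (S \ B) ≤ ENNReal.ofReal (Real.exp E) * Q S := by
    rw [hPQ, withDensity_apply _ (hS.diff hBm)]
    calc _ ≤ ∫⁻ x in S \ B, ENNReal.ofReal (Real.exp E) ∂Q := by
          refine setLIntegral_mono measurable_const fun x hx => ?_
          apply ENNReal.ofReal_le_ofReal
          exact Real.exp_le_exp.2 (not_le.1 hx.2).le
      _ = ENNReal.ofReal (Real.exp E) * Q (S \ B) := setLIntegral_const _ _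
      _ ≤ _ := by gcongr; exact Set.diff_subset
  have hs0 : 0 ≤ s := by positivity
  have hlog : 0 < Real.log (1 / δ') := Real.log_pos (by rw [lt_div_iff₀ hδ'0]; linarith)
  have hbad : P.real B ≤ δ' := by
    have hind : ProbabilityTheory.iIndepFun (fun t (x : Fin T → ℝ) => lapLoss σ (a t) (b t) (x t)
        - ∫ y, lapLoss σ (a t) (b t) y ∂(laplaceMeasure (a t) σ)) P :=
      ProbabilityTheory.iIndepFun_pi (X := fun t y => lapLoss σ (a t) (b t) y
        - ∫ y, lapLoss σ (a t) (b t) y ∂(laplaceMeasure (a t) σ))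
        fun t => ((hm t).sub_const _).aemeasurable
    have hsub : ∀ t ∈ (Finset.univ : Finset (Fin T)), ProbabilityTheory.HasSubgaussianMGF
        (fun (x : Fin T → ℝ) => lapLoss σ (a t) (b t) (x t)
        - ∫ y, lapLoss σ (a t) (b t) y ∂(laplaceMeasure (a t) σ))
        ((‖1 / σ - -(1 / σ)‖₊ / 2) ^ 2) P := by
      intro t _
      have h := ProbabilityTheory.hasSubgaussianMGF_of_mem_Icc (μ := P)
        (X := fun x => lapLoss σ (a t) (b t) (x t)) (a := -(1 / σ)) (b := 1 / σ)
        ((hm t).comp (measurable_pi_apply t)).aemeasurable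
        (ae_of_all _ fun x => abs_le.1 (abs_lapLoss_le σ _ _ _ hσ (hab t)))
      have h2 : ∫ x, lapLoss σ (a t) (b t) (x t) ∂P =
          ∫ y, lapLoss σ (a t) (b t) y ∂(laplaceMeasure (a t) σ) := by
        rw [← (measurePreserving_eval (fun t => laplaceMeasure (a t) σ) t).map_eq,
          integral_map (measurable_pi_apply t).aemeasurable (hm t).aestronglyMeasurable]
      rwa [h2] at h
    have hh := ProbabilityTheory.HasSubgaussianMGF.measure_sum_ge_le_of_iIndepFun hind hsub hs0
    have hle : P.real B ≤ P.real {x | s ≤ ∑ t, (lapLoss σ (a t) (b t) (x t)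
        - ∫ y, lapLoss σ (a t) (b t) y ∂(laplaceMeasure (a t) σ))} := by
      refine measureReal_mono fun x hx => ?_
      simp only [hB, Set.mem_setOf_eq] at hx ⊢
      rw [Finset.sum_sub_distrib]
      have : ∑ t, ∫ y, lapLoss σ (a t) (b t) y ∂(laplaceMeasure (a t) σ) ≤
          ∑ t : Fin T, 1 / σ * (Real.exp (1 / σ) - 1) :=
        Finset.sum_le_sum fun t _ => integral_lapLoss_le σ _ _ hσ (hab t)
      simp only [Finset.sum_const, Finset.card_univ, Fintype.card_fin, nsmul_eq_mul] at this
      linarith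
    refine (hle.trans hh).trans (le_of_eq ?_)
    have hc : (((‖1 / σ - -(1 / σ)‖₊ / 2) ^ 2 : NNReal) : ℝ) = (1 / σ) ^ 2 := by
      push_cast
      rw [Real.norm_eq_abs, div_pow, sq_abs]
      ring
    have hT' : (0 : ℝ) < T := by exact_mod_cast hT
    have : -s ^ 2 / (2 * ∑ _t : Fin T, (1 / σ) ^ 2) = -Real.log (1 / δ') := by
      rw [hs, mul_pow, Real.sq_sqrt (by positivity)]
      simp only [Finset.sum_const, Finset.card_univ, Fintype.card_fin, nsmul_eq_mul]
      field_simp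
    simp only [NNReal.coe_sum, hc]
    rw [this, one_div, Real.log_inv, neg_neg, Real.exp_log hδ'0]
  have hbad' : P B ≤ ENNReal.ofReal δ' := by
    rw [← ofReal_measureReal]
    exact ENNReal.ofReal_le_ofReal hbad
  calc P S ≤ P ((S \ B) ∪ B) := measure_mono (by simp)
    _ ≤ P (S \ B) + P B := measure_union_le _ _
    _ ≤ _ := add_le_add hgood hbad'
end

section
/- Let I be a nonempty finite index set (of intersectional demographic groups). For each a ∈ I let S_a⁰, S_a¹ ≥ 0 be reals with n_a := S_a⁰ + S_a¹ ≥ m for some m > 0, let P_a = S_a¹/n_a, and let e_a⁰, e_a¹ be reals with |e_a⁰| ≤ B and |e_a¹| ≤ B for some B ≥ 0 with 4B ≤ m. Define P̂_a = (S_a¹ + e_a¹)/(n_a + e_a⁰ + e_a¹). Then the estimated maximum intersectional disparity satisfies | max_{a,b ∈ I} |P̂_a − P̂_b| − max_{a,b ∈ I} |P_a − P_b| | ≤ 12B/m. (This is the approximation error bound for intersectional fairness verification: the noised estimate of the maximum disparity in positive-prediction rates across intersectional groups deviates from the true value by at most a quantity inversely proportional to the size of the smallest intersectional group.) -/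
open Finset

lemma rate_error (s t u v m B : ℝ) (hm : 0 < m) (hs : 0 ≤ s) (ht : 0 ≤ t) (hn : m ≤ s + t)
    (hB : 0 ≤ B) (hu : |u| ≤ B) (hv : |v| ≤ B) (h4 : 4 * B ≤ m) :
    |(t + v) / (s + t + u + v) - t / (s + t)| ≤ 6 * B / m := by
  rw [abs_le] at hu hv
  obtain ⟨hu1, hu2⟩ := hu
  obtain ⟨hv1, hv2⟩ := hv
  have hd : m / 2 ≤ s + t + u + v := by linarith
  have hd0 : 0 < s + t + u + v := by linarith
  have hn0 : 0 < s + t := by linarith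
  have key : (t + v) / (s + t + u + v) - t / (s + t)
      = (v * s - u * t) / (s + t) / (s + t + u + v) := by
    field_simp
    ring
  have h1 : |(v * s - u * t) / (s + t)| ≤ B := by
    rw [abs_div, abs_of_pos hn0, div_le_iff₀ hn0, abs_le]
    constructor <;> nlinarith
  rw [key, abs_div, abs_of_pos hd0]
  calc |(v * s - u * t) / (s + t)| / (s + t + u + v) ≤ B / (m / 2) := by gcongr
    _ = 2 * B / m := by field_simp
    _ ≤ 6 * B / m := by gcongr; norm_num

lemma sup_diff_le {J : Type*} [Fintype J] [Nonempty J] (f g : J → ℝ) (c : ℝ)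
    (h : ∀ p, |f p - g p| ≤ c) :
    |(Finset.univ : Finset J).sup' univ_nonempty f -
      (Finset.univ : Finset J).sup' univ_nonempty g| ≤ c := by
  rw [abs_sub_le_iff]
  constructor
  · rw [sub_le_iff_le_add]
    refine Finset.sup'_le _ _ fun p hp => ?_
    have := Finset.le_sup' g hp
    have := (abs_le.1 (h p)).2
    linarith
  · rw [sub_le_iff_le_add]
    refine Finset.sup'_le _ _ fun p hp => ?_
    have := Finset.le_sup' f hp
    have := (abs_le.1 (h p)).1
    linarith

/-- **Approximation error bound for intersectional fairness verification.**
For a nonempty finite family of intersectional groups, each with counts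
`S a y ≥ 0`, group size `n_a = S a 0 + S a 1 ≥ m > 0`, true rate
`P a = S a 1 / n_a`, and noised rate
`P̂ a = (S a 1 + e a 1) / (n_a + e a 0 + e a 1)` where `|e a y| ≤ B` and
`4B ≤ m`, the estimated maximum intersectional disparity satisfies
`| max_{a,b} |P̂ a − P̂ b| − max_{a,b} |P a − P b| | ≤ 12B/m`. -/
theorem noised_intersectional_disparity_accuracy
    {I : Type*} [Fintype I] [Nonempty I]
    (S e : I → Fin 2 → ℝ) (m B : ℝ) (hm : 0 < m)
    (hS : ∀ a y, 0 ≤ S a y)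
    (hn : ∀ a, m ≤ S a 0 + S a 1)
    (hB : 0 ≤ B) (he : ∀ a y, |e a y| ≤ B) (h4B : 4 * B ≤ m) :
    abs
      ((Finset.univ : Finset (I × I)).sup' (univ_nonempty)
          (fun p =>
            |(S p.1 1 + e p.1 1) / (S p.1 0 + S p.1 1 + e p.1 0 + e p.1 1) -
              (S p.2 1 + e p.2 1) / (S p.2 0 + S p.2 1 + e p.2 0 + e p.2 1)|) -
        (Finset.univ : Finset (I × I)).sup' (univ_nonempty)
          (fun p =>
            |S p.1 1 / (S p.1 0 + S p.1 1) - S p.2 1 / (S p.2 0 + S p.2 1)|)) ≤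
      12 * B / m := by
  refine sup_diff_le _ _ _ fun p => ?_
  have h (a : I) := rate_error (S a 0) (S a 1) (e a 0) (e a 1) m B hm (hS a 0) (hS a 1) (hn a)
    hB (he a 0) (he a 1) h4B
  have h1 := h p.1
  have h2 := h p.2
  refine (abs_abs_sub_abs_le _ _).trans ?_
  have h12 : 12 * B / m = 6 * B / m + 6 * B / m := by ring
  rw [h12]
  rw [abs_le] at h1 h2 ⊢
  constructor <;> linarith [h1.1, h1.2, h2.1, h2.2]
end
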